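/- arXiv:1009.5360 — 4 statements merged into one kernel-verified Lean document; each statement's English description precedes it below -/
import Mathlib

section
/- For every integer h ≥ 2 there exists N₀ = N₀(h), depending only on h, such that for all integers N > N₀ there exists a positive integer n with: (i) n is the sum of N distinct, pairwise non-adjacent Fibonacci numbers (i.e., s_F(n) = N), and (ii) n^h is the sum of at most 130h² Fibonacci numbers (i.e., s_F(n^h) ≤ 130h²). -/
/-- Zeckendorf sum of digits: number of summands in the Zeckendorf
representation of `n` (equivalently, minimal number of Fibonacci numbers
needed to write `n` as a sum of Fibonacci numbers). -/
def sF (n : ℕ) : ℕ := (Nat.zeckendorf n).length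

/-- Lucas numbers: `L 0 = 2`, `L k = F (k-1) + F (k+1)` for `k ≥ 1`. -/
def lucas : ℕ → ℕ
  | 0 => 2
  | k + 1 => Nat.fib k + Nat.fib (k + 2)

/-! ### Subadditivity of the Zeckendorf sum of digits -/

lemma sF_zero : sF 0 = 0 := by simp [sF]

/-- Removing the leading Fibonacci number lowers the sum of digits by one. -/
lemma sF_fib_add {g r : ℕ} (hg : 2 ≤ g) (hr : r < Nat.fib (g - 1)) :
    sF (Nat.fib g + r) = sF r + 1 := by
  obtain ⟨m, rfl⟩ : ∃ m, g = m + 2 := ⟨g - 2, by omega⟩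
  have hpos : 0 < Nat.fib (m + 2) := Nat.fib_pos.2 (by omega)
  have hgreatest : Nat.greatestFib (Nat.fib (m + 2) + r) = m + 2 := by
    apply le_antisymm
    · rw [← Nat.lt_succ_iff, Nat.greatestFib_lt, Nat.succ_eq_add_one,
        show Nat.fib (m + 2 + 1) = _ from Nat.fib_add_two (n := m + 1)]
      change _ < _ + Nat.fib (m + 2)
      have : m + 2 - 1 = m + 1 := rfl
      rw [this] at hr
      omega
    · rw [Nat.le_greatestFib]
      omega
  unfold sF
  rw [Nat.zeckendorf_of_pos (by omega), hgreatest, Nat.add_sub_cancel_left, List.length_cons]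

/-- Every positive integer splits into its leading Fibonacci number and a small remainder. -/
lemma exists_eq_fib_add {n : ℕ} (hn : 0 < n) :
    ∃ m r, n = Nat.fib (m + 2) + r ∧ r < Nat.fib (m + 1) := by
  have h2 : 2 ≤ Nat.greatestFib n := by
    rw [Nat.le_greatestFib]
    simpa using Nat.succ_le_of_lt hn
  obtain ⟨m, hm⟩ : ∃ m, Nat.greatestFib n = m + 2 := ⟨Nat.greatestFib n - 2, by omega⟩
  have hle := Nat.fib_greatestFib_le n
  have hlt := Nat.lt_fib_greatestFib_add_one n
  rw [hm] at hle hlt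
  have f3 : Nat.fib (m + 2 + 1) = Nat.fib (m + 1) + Nat.fib (m + 2) := Nat.fib_add_two
  exact ⟨m, n - Nat.fib (m + 2), by omega, by omega⟩

/-- Adding a Fibonacci number increases the sum of digits by at most one. -/
lemma sF_add_fib_le (n j : ℕ) : sF (n + Nat.fib j) ≤ sF n + 1 := by
  induction n using Nat.strong_induction_on generalizing j with
  | _ n ih =>
    wlog hj : 2 ≤ j generalizing j
    · obtain rfl | rfl : j = 0 ∨ j = 1 := by omega
      · simp
      · simpa using this 2 le_rfl
    obtain rfl | hn := Nat.eq_zero_or_pos n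
    · rw [Nat.add_comm, sF_fib_add hj (Nat.fib_pos.2 (by omega))]
    obtain ⟨m, r, rfl, hr⟩ := exists_eq_fib_add hn
    have hpos : 0 < Nat.fib (m + 2) := Nat.fib_pos.2 (by omega)
    have f2 : Nat.fib (m + 2) = Nat.fib m + Nat.fib (m + 1) := Nat.fib_add_two
    have f3 : Nat.fib (m + 3) = Nat.fib (m + 1) + Nat.fib (m + 2) := Nat.fib_add_two
    have f4 : Nat.fib (m + 4) = Nat.fib (m + 2) + Nat.fib (m + 3) := Nat.fib_add_two
    have hn : sF (Nat.fib (m + 2) + r) = sF r + 1 := sF_fib_add (by omega) hr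
    have ihr := ih r (by omega)
    obtain hjm | rfl | rfl | rfl | hjm :
        m + 4 ≤ j ∨ j = m + 3 ∨ j = m + 2 ∨ j = m + 1 ∨ j ≤ m := by omega
    · have : Nat.fib (m + 3) ≤ Nat.fib (j - 1) := Nat.fib_mono (by omega)
      rw [Nat.add_comm, sF_fib_add hj (by omega)]
    · have e : Nat.fib (m + 2) + r + Nat.fib (m + 3) = Nat.fib (m + 4) + r := by omega
      rw [e, sF_fib_add (by omega) (show r < Nat.fib (m + 3) by omega)]
      omega
    · have e : Nat.fib (m + 2) + r + Nat.fib (m + 2) = Nat.fib (m + 3) + (r + Nat.fib m) := by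
        omega
      rw [e, sF_fib_add (by omega) (show r + Nat.fib m < Nat.fib (m + 2) by omega), hn]
      have := ihr m
      omega
    · have e : Nat.fib (m + 2) + r + Nat.fib (m + 1) = Nat.fib (m + 3) + r := by omega
      rw [e, sF_fib_add (by omega) (show r < Nat.fib (m + 2) by omega)]
      omega
    · have hjle : Nat.fib j ≤ Nat.fib m := Nat.fib_mono hjm
      have := ihr j
      obtain hlt | hge := Nat.lt_or_ge (r + Nat.fib j) (Nat.fib (m + 1))
      · rw [Nat.add_assoc, sF_fib_add (by omega) hlt, hn]
        omega
      · obtain ⟨i, rfl⟩ : ∃ i, m = i + 1 := ⟨m - 1, by omega⟩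
        have f1 : Nat.fib (i + 2) = Nat.fib i + Nat.fib (i + 1) := Nat.fib_add_two
        obtain ⟨t, ht⟩ := Nat.exists_eq_add_of_le hge
        have htop : sF (Nat.fib (i + 2) + t) = sF t + 1 := by
          refine sF_fib_add (by omega) (show t < Nat.fib (i + 1) from ?_)
          change r < Nat.fib (i + 2) at hr
          change r + Nat.fib j = Nat.fib (i + 2) + t at ht
          omega
        have e : Nat.fib (i + 1 + 2) + r + Nat.fib j = Nat.fib (i + 1 + 3) + t := by omega
        have ht' : t < Nat.fib (i + 1 + 2) := by omega
        rw [e, sF_fib_add (by omega) ht', hn]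
        rw [ht] at this
        change sF (Nat.fib (i + 2) + t) ≤ _ at this
        omega

lemma sF_fib_le (j : ℕ) : sF (Nat.fib j) ≤ 1 := by
  simpa [sF_zero] using sF_add_fib_le 0 j

lemma sF_add_le (a b : ℕ) : sF (a + b) ≤ sF a + sF b := by
  induction b using Nat.strong_induction_on generalizing a with
  | _ b ih =>
    obtain rfl | hb := Nat.eq_zero_or_pos b
    · simp
    obtain ⟨m, r, rfl, hr⟩ := exists_eq_fib_add hb
    have hpos : 0 < Nat.fib (m + 2) := Nat.fib_pos.2 (by omega)
    have h1 := ih r (by omega) (a + Nat.fib (m + 2))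
    have h2 := sF_add_fib_le a (m + 2)
    rw [sF_fib_add (by omega) hr, ← Nat.add_assoc]
    omega

lemma sF_mul_le (d x : ℕ) : sF (d * x) ≤ d * sF x := by
  induction d with
  | zero => simp [sF_zero]
  | succ d ih =>
    rw [Nat.succ_mul, Nat.succ_mul]
    exact (sF_add_le _ _).trans (by omega)

lemma sF_sum_le {ι : Type*} (s : Finset ι) (f : ι → ℕ) :
    sF (∑ i ∈ s, f i) ≤ ∑ i ∈ s, sF (f i) :=
  Finset.le_sum_of_subadditive _ sF_zero.le sF_add_le _ _

/-! ### Lucas numbers of even index -/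

lemma lucas_two_mul_cast (j : ℕ) :
    (lucas (2 * j) : ℤ) = Int.fib (2 * j - 1) + Int.fib (2 * j + 1) := by
  cases j with
  | zero => simp [lucas]
  | succ j =>
    have e : 2 * (j + 1) = 2 * j + 1 + 1 := by ring
    rw [e, lucas, Nat.cast_add, ← Int.fib_natCast, ← Int.fib_natCast]
    congr 2
    all_goals
      push_cast
      ring

lemma fib_add_two_mul_add_fib_sub_two_mul (a : ℤ) (j : ℕ) :
    Int.fib (a + 2 * j) + Int.fib (a - 2 * j) = lucas (2 * j) * Int.fib a := by
  have heven : Even (2 * (j : ℤ)) := even_two_mul _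
  have hodd : ¬ Even (2 * (j : ℤ) - 1) := by
    rw [Int.not_even_iff_odd]
    exact ⟨j - 1, by ring⟩
  have h1 := Int.fib_add a (2 * j)
  have h2 := Int.fib_add a (-(2 * j))
  have h3 := Int.fib_neg (2 * (j : ℤ) - 1)
  rw [Int.fib_neg, if_pos heven] at h2
  rw [if_neg hodd] at h3
  have e : -(2 * (j : ℤ)) + 1 = -(2 * j - 1) := by ring
  rw [e, h3] at h2
  rw [sub_eq_add_neg, h1, h2, lucas_two_mul_cast]
  ring

lemma lucas_two_mul_add_four (j : ℕ) :
    lucas (2 * (j + 2)) + lucas (2 * j) = 3 * lucas (2 * (j + 1)) := by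
  zify
  simp only [lucas_two_mul_cast]
  have h := Int.fib_add_two (2 * (j : ℤ) - 1)
  have h1 := Int.fib_add_two (2 * (j : ℤ))
  have h2 := Int.fib_add_two (2 * (j : ℤ) + 1)
  have h3 := Int.fib_add_two (2 * (j : ℤ) + 2)
  have h4 := Int.fib_add_two (2 * (j : ℤ) + 3)
  push_cast
  ring_nf at *
  linarith

lemma lucas_two_mul_growth (j : ℕ) :
    2 ^ j ≤ lucas (2 * j) ∧ lucas (2 * j) + 2 ^ j ≤ lucas (2 * (j + 1)) ∧
      lucas (2 * (j + 1)) ≤ 3 * lucas (2 * j) := by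
  induction j with
  | zero => decide
  | succ j ih =>
    have := lucas_two_mul_add_four j
    rw [show j + 1 + 1 = j + 2 from rfl, pow_succ]
    omega

/-- A small multiple of a Fibonacci number of odd index has few digits: expand the multiplier
greedily in Lucas numbers of even index. -/
lemma sF_mul_fib_natAbs_le (M c : ℕ) (hc : c < lucas (2 * M)) (a : ℤ) (ha : Odd a) :
    sF (c * Nat.fib a.natAbs) ≤ 4 * M + 1 := by
  induction M generalizing c with
  | zero =>
    have : c < 2 := by simpa [lucas] using hc
    exact (sF_mul_le _ _).trans (by nlinarith [sF_fib_le a.natAbs])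
  | succ M ih =>
    have hg := (lucas_two_mul_growth M).2.2
    have hpow := (lucas_two_mul_growth M).1
    have htwo : 0 < 2 ^ M := by positivity
    have hpos : 0 < lucas (2 * M) := by omega
    have hd : c / lucas (2 * M) < 3 := by
      rw [Nat.div_lt_iff_lt_mul hpos]
      omega
    have hr := ih (c % lucas (2 * M)) (Nat.mod_lt _ hpos)
    have hL : lucas (2 * M) * Nat.fib a.natAbs =
        Nat.fib (a + 2 * M).natAbs + Nat.fib (a - 2 * M).natAbs := by
      have h := fib_add_two_mul_add_fib_sub_two_mul a M
      rw [Int.fib_of_odd ha, Int.fib_of_odd (ha.add_even (even_two_mul _)),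
        Int.fib_of_odd (ha.sub_even (even_two_mul _))] at h
      exact_mod_cast h.symm
    have hL2 : sF (lucas (2 * M) * Nat.fib a.natAbs) ≤ 2 := by
      rw [hL]
      exact (sF_add_le _ _).trans (Nat.add_le_add (sF_fib_le _) (sF_fib_le _))
    have e : c * Nat.fib a.natAbs = c / lucas (2 * M) * (lucas (2 * M) * Nat.fib a.natAbs) +
        c % lucas (2 * M) * Nat.fib a.natAbs := by
      conv_lhs => rw [← Nat.div_add_mod c (lucas (2 * M))]
      ring
    rw [e]
    refine (sF_add_le _ _).trans ?_
    have := sF_mul_le (c / lucas (2 * M)) (lucas (2 * M) * Nat.fib a.natAbs)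
    nlinarith

/-! ### A polynomial with a negative coefficient whose powers have none -/

open Polynomial in
/-- A reciprocal polynomial with a negative coefficient all of whose higher powers have
nonnegative coefficients. -/
noncomputable def basePoly : ℤ[X] := 3 * X ^ 4 + 3 * X ^ 3 - X ^ 2 + 3 * X + 3

open Polynomial in
lemma exists_map_eq_basePoly_pow (h : ℕ) (hh : 2 ≤ h) :
    ∃ P : ℕ[X], P.map (Nat.castRingHom ℤ) = basePoly ^ h := by
  induction h using Nat.strong_induction_on with
  | _ h ih =>
    have two : ∃ P : ℕ[X], P.map (Nat.castRingHom ℤ) = basePoly ^ 2 := by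
      refine ⟨9 * X ^ 8 + 18 * X ^ 7 + 3 * X ^ 6 + 12 * X ^ 5 + 37 * X ^ 4 + 12 * X ^ 3 +
        3 * X ^ 2 + 18 * X + 9, ?_⟩
      simp only [Polynomial.map_add, Polynomial.map_mul, Polynomial.map_pow, Polynomial.map_X,
        Polynomial.map_ofNat, basePoly]
      ring
    obtain rfl | rfl | h4 : h = 2 ∨ h = 3 ∨ 4 ≤ h := by omega
    · exact two
    · refine ⟨27 * X ^ 12 + 81 * X ^ 11 + 54 * X ^ 10 + 54 * X ^ 9 + 225 * X ^ 8 + 198 * X ^ 7 +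
        53 * X ^ 6 + 198 * X ^ 5 + 225 * X ^ 4 + 54 * X ^ 3 + 54 * X ^ 2 + 81 * X + 27, ?_⟩
      simp only [Polynomial.map_add, Polynomial.map_mul, Polynomial.map_pow, Polynomial.map_X,
        Polynomial.map_ofNat, basePoly]
      ring
    · obtain ⟨P, hP⟩ := ih (h - 2) (by omega) (by omega)
      obtain ⟨Q, hQ⟩ := two
      refine ⟨P * Q, ?_⟩
      rw [Polynomial.map_mul, hP, hQ, ← pow_add]
      congr 1
      omega

open Polynomial in
/-- The coefficients of the powers of `basePoly`. -/
lemma exists_coeff_basePoly_pow (h : ℕ) (hh : 2 ≤ h) :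
    ∃ c : ℕ → ℕ, (∀ i, c i ≤ 11 ^ h) ∧ ∀ {A : Type} [Ring A] (x : A),
      aeval x (basePoly ^ h) = ∑ i ∈ Finset.range (4 * h + 1), (c i : ℤ) • x ^ i := by
  obtain ⟨P, hP⟩ := exists_map_eq_basePoly_pow h hh
  have hcoeff (i : ℕ) : (basePoly ^ h).coeff i = P.coeff i := by
    rw [← hP]
    simp
  have heval : P.eval 1 = 11 ^ h := by
    have h1 : (basePoly ^ h).eval 1 = 11 ^ h := by
      norm_num [basePoly]
    rw [← hP, Polynomial.eval_one_map, eq_natCast] at h1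
    exact_mod_cast h1
  refine ⟨P.coeff, fun i => ?_, fun {A} _ x => ?_⟩
  · rw [← heval, Polynomial.eval_eq_sum_range]
    simp only [one_pow, mul_one]
    obtain hi | hi := Nat.lt_or_ge P.natDegree i
    · simp [Polynomial.coeff_eq_zero_of_natDegree_lt hi]
    · exact Finset.single_le_sum (f := P.coeff) (fun _ _ => Nat.zero_le _)
        (Finset.mem_range.2 (by omega))
  · have hdeg : (basePoly ^ h).natDegree ≤ h * 4 :=
      Polynomial.natDegree_pow_le_of_le h (by unfold basePoly; compute_degree)
    rw [Polynomial.aeval_eq_sum_range' (show _ < 4 * h + 1 by omega)]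
    simp only [hcoeff]

open Polynomial in
/-- Evaluating the powers of `basePoly` at a shift operator acting on Fibonacci numbers. -/
lemma pow_mul_fib_eq_sum (h k n : ℕ) (hn : n + 1 = 3 * lucas (2 * (2 * k)) + 3 * lucas (2 * k))
    (c : ℕ → ℕ) (hc : ∀ {A : Type} [Ring A] (x : A),
      aeval x (basePoly ^ h) = ∑ i ∈ Finset.range (4 * h + 1), (c i : ℤ) • x ^ i) (s : ℤ) :
    (n : ℤ) ^ h * Int.fib (s + 4 * k * h) =
      ∑ i ∈ Finset.range (4 * h + 1), (c i : ℤ) * Int.fib (s + 2 * k * i) := by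
  let T : Module.End ℤ (ℤ → ℤ) := LinearMap.funLeft ℤ ℤ fun t => t + 2 * k
  have hT (i : ℕ) (f : ℤ → ℤ) (t : ℤ) : (T ^ i) f t = f (t + 2 * k * i) := by
    induction i generalizing t with
    | zero => simp
    | succ i ih =>
      rw [pow_succ', Module.End.mul_apply]
      change (T ^ i) f (t + 2 * k) = _
      rw [ih]
      congr 1
      push_cast
      ring
  have hbase (m : ℤ) : aeval T basePoly (fun t => Int.fib (t + m)) =
      (n : ℤ) • fun t => Int.fib (t + (m + 4 * k)) := by
    funext t
    have h1 := fib_add_two_mul_add_fib_sub_two_mul (t + (m + 4 * k)) k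
    have h2 := fib_add_two_mul_add_fib_sub_two_mul (t + (m + 4 * k)) (2 * k)
    have hn' : (n : ℤ) = 3 * lucas (2 * (2 * k)) + 3 * lucas (2 * k) - 1 := by
      rw [eq_sub_iff_add_eq]
      exact_mod_cast hn
    have e : aeval T basePoly = (3 : ℤ) • T ^ 4 + (3 : ℤ) • T ^ 3 - T ^ 2 + (3 : ℤ) • T ^ 1 +
        (3 : ℤ) • T ^ 0 := by
      simp [basePoly, Algebra.smul_def, map_ofNat (aeval T)]
    rw [e]
    simp only [LinearMap.add_apply, LinearMap.sub_apply, LinearMap.smul_apply, Pi.add_apply,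
      Pi.sub_apply, Pi.smul_apply, hT, smul_eq_mul]
    rw [hn']
    push_cast at h2 ⊢
    ring_nf at h1 h2 ⊢
    linear_combination 3 * h1 + 3 * h2
  have hpow (j : ℕ) (m : ℤ) : (aeval T basePoly ^ j) (fun t => Int.fib (t + m)) =
      (n : ℤ) ^ j • fun t => Int.fib (t + (m + 4 * k * j)) := by
    induction j generalizing m with
    | zero => simp
    | succ j ih =>
      rw [pow_succ, Module.End.mul_apply, hbase, map_smul, ih, smul_smul, ← pow_succ']
      congr 1
      funext t
      congr 1
      push_cast
      ring
  have key := congrFun (hpow h s) 0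
  rw [← map_pow, hc T] at key
  simp only [LinearMap.sum_apply, Finset.sum_apply, LinearMap.smul_apply, Pi.smul_apply, hT,
    smul_eq_mul, zero_add] at key
  rw [← key]
  refine Finset.sum_congr rfl fun i _ => ?_
  rw [add_comm s]

lemma sF_pow_le (h k n : ℕ) (hh : 2 ≤ h)
    (hn : n + 1 = 3 * lucas (2 * (2 * k)) + 3 * lucas (2 * k)) :
    sF (n ^ h) ≤ 130 * h ^ 2 := by
  obtain ⟨c, hc, hsum⟩ := exists_coeff_basePoly_pow h hh
  have hodd (i : ℕ) : Odd (-1 - 4 * k * h + 2 * k * i : ℤ) :=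
    ⟨-1 - 2 * k * h + k * i, by ring⟩
  have key := pow_mul_fib_eq_sum h k n hn c hsum (-1 - 4 * k * h)
  rw [sub_add_cancel, Int.fib_neg_one, mul_one] at key
  simp only [Int.fib_of_odd (hodd _)] at key
  have key' : n ^ h = ∑ i ∈ Finset.range (4 * h + 1),
      c i * Nat.fib (-1 - 4 * k * h + 2 * k * i : ℤ).natAbs := by
    exact_mod_cast key
  have hsmall (i : ℕ) : c i < lucas (2 * (4 * h)) := by
    calc c i ≤ 11 ^ h := hc i
      _ < 16 ^ h := Nat.pow_lt_pow_left (by norm_num) (by omega)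
      _ = 2 ^ (4 * h) := by rw [pow_mul]; norm_num
      _ ≤ lucas (2 * (4 * h)) := (lucas_two_mul_growth _).1
  rw [key']
  refine (sF_sum_le _ _).trans ?_
  refine (Finset.sum_le_card_nsmul _ _ (4 * (4 * h) + 1) fun i _ =>
    sF_mul_fib_natAbs_le _ _ (hsmall i) _ (hodd i)).trans ?_
  rw [Finset.card_range, smul_eq_mul]
  nlinarith

/-! ### The sum of digits of the base -/

lemma sF_fib_two_mul_add_one_sub_one (m : ℕ) : sF (Nat.fib (2 * m + 1) - 1) = m := by
  induction m with
  | zero => simp [sF_zero]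
  | succ m ih =>
    have hpos : 0 < Nat.fib (2 * m + 1) := Nat.fib_pos.2 (by omega)
    have f3 : Nat.fib (2 * m + 3) = Nat.fib (2 * m + 1) + Nat.fib (2 * m + 2) := Nat.fib_add_two
    have e : Nat.fib (2 * (m + 1) + 1) - 1 =
        Nat.fib (2 * m + 2) + (Nat.fib (2 * m + 1) - 1) := by
      rw [show 2 * (m + 1) + 1 = 2 * m + 3 by ring]
      omega
    rw [e, sF_fib_add (by omega) (show _ < Nat.fib (2 * m + 1) by omega), ih]

lemma three_mul_lucas (j : ℕ) : 3 * lucas (j + 4) =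
    Nat.fib (j + 7) + (Nat.fib (j + 5) + (Nat.fib (j + 3) + Nat.fib (j + 1))) := by
  have f2 : Nat.fib (j + 2) = Nat.fib j + Nat.fib (j + 1) := Nat.fib_add_two
  have f3 : Nat.fib (j + 3) = Nat.fib (j + 1) + Nat.fib (j + 2) := Nat.fib_add_two
  have f4 : Nat.fib (j + 4) = Nat.fib (j + 2) + Nat.fib (j + 3) := Nat.fib_add_two
  have f5 : Nat.fib (j + 5) = Nat.fib (j + 3) + Nat.fib (j + 4) := Nat.fib_add_two
  have f6 : Nat.fib (j + 6) = Nat.fib (j + 4) + Nat.fib (j + 5) := Nat.fib_add_two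
  have f7 : Nat.fib (j + 7) = Nat.fib (j + 5) + Nat.fib (j + 6) := Nat.fib_add_two
  change 3 * (Nat.fib (j + 3) + Nat.fib (j + 5)) = _
  omega

/-- Three times a Lucas number consists of four digits, which may sit on top of any small
remainder. -/
lemma sF_three_mul_lucas_add (j x : ℕ) (hj : 1 ≤ j) (hx : x < Nat.fib j) :
    sF (3 * lucas (j + 4) + x) = sF x + 4 := by
  have f2 : Nat.fib (j + 2) = Nat.fib j + Nat.fib (j + 1) := Nat.fib_add_two
  have f3 : Nat.fib (j + 3) = Nat.fib (j + 1) + Nat.fib (j + 2) := Nat.fib_add_two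
  have f4 : Nat.fib (j + 4) = Nat.fib (j + 2) + Nat.fib (j + 3) := Nat.fib_add_two
  have f5 : Nat.fib (j + 5) = Nat.fib (j + 3) + Nat.fib (j + 4) := Nat.fib_add_two
  have f6 : Nat.fib (j + 6) = Nat.fib (j + 4) + Nat.fib (j + 5) := Nat.fib_add_two
  rw [three_mul_lucas, Nat.add_assoc, Nat.add_assoc, Nat.add_assoc,
    sF_fib_add (by omega) (show _ < Nat.fib (j + 6) by omega),
    sF_fib_add (by omega) (show _ < Nat.fib (j + 4) by omega),
    sF_fib_add (by omega) (show _ < Nat.fib (j + 2) by omega),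
    sF_fib_add (by omega) (show _ < Nat.fib j by omega)]

lemma sF_three_mul_lucas_sub_one (m : ℕ) : sF (3 * lucas (2 * m + 4) - 1) = m + 3 := by
  have hpos : 0 < Nat.fib (2 * m + 1) := Nat.fib_pos.2 (by omega)
  have f2 : Nat.fib (2 * m + 2) = Nat.fib (2 * m) + Nat.fib (2 * m + 1) := Nat.fib_add_two
  have f3 : Nat.fib (2 * m + 3) = Nat.fib (2 * m + 1) + Nat.fib (2 * m + 2) := Nat.fib_add_two
  have f4 : Nat.fib (2 * m + 4) = Nat.fib (2 * m + 2) + Nat.fib (2 * m + 3) := Nat.fib_add_two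
  have f5 : Nat.fib (2 * m + 5) = Nat.fib (2 * m + 3) + Nat.fib (2 * m + 4) := Nat.fib_add_two
  have f6 : Nat.fib (2 * m + 6) = Nat.fib (2 * m + 4) + Nat.fib (2 * m + 5) := Nat.fib_add_two
  rw [three_mul_lucas, Nat.add_sub_assoc (by omega), Nat.add_sub_assoc (by omega),
    Nat.add_sub_assoc (by omega),
    sF_fib_add (by omega) (show _ < Nat.fib (2 * m + 6) by omega),
    sF_fib_add (by omega) (show _ < Nat.fib (2 * m + 4) by omega),
    sF_fib_add (by omega) (show _ < Nat.fib (2 * m + 2) by omega),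
    sF_fib_two_mul_add_one_sub_one]

lemma three_mul_lucas_lt (j : ℕ) : 3 * lucas (j + 4) < Nat.fib (j + 8) + 1 := by
  have f2 : Nat.fib (j + 2) = Nat.fib j + Nat.fib (j + 1) := Nat.fib_add_two
  have f4 : Nat.fib (j + 4) = Nat.fib (j + 2) + Nat.fib (j + 3) := Nat.fib_add_two
  have f6 : Nat.fib (j + 6) = Nat.fib (j + 4) + Nat.fib (j + 5) := Nat.fib_add_two
  have f8 : Nat.fib (j + 8) = Nat.fib (j + 6) + Nat.fib (j + 7) := Nat.fib_add_two
  rw [three_mul_lucas]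
  omega

theorem stmt_3 (h : ℕ) (hh : 2 ≤ h) :
    ∃ N₀ : ℕ, ∀ N : ℕ, N₀ < N →
      ∃ n : ℕ, 0 < n ∧ sF n = N ∧ sF (n ^ h) ≤ 130 * h ^ 2 := by
  refine ⟨8, fun N hN => ?_⟩
  obtain ⟨m, rfl⟩ : ∃ m, N = m + 7 := ⟨N - 7, by omega⟩
  have hpos : 0 < lucas (2 * m + 4) := Nat.add_pos_left (Nat.fib_pos.2 (by omega)) _
  have hlt : 3 * lucas (2 * m + 4) - 1 < Nat.fib (4 * m + 4) := by
    have h1 := three_mul_lucas_lt (2 * m)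
    have h2 : Nat.fib (2 * m + 8) ≤ Nat.fib (4 * m + 4) := Nat.fib_mono (by omega)
    omega
  refine ⟨3 * lucas (4 * m + 4 + 4) + (3 * lucas (2 * m + 4) - 1), by omega, ?_,
    sF_pow_le h (m + 2) _ hh ?_⟩
  · rw [sF_three_mul_lucas_add _ _ (by omega) hlt, sF_three_mul_lucas_sub_one]
  · rw [show 2 * (2 * (m + 2)) = 4 * m + 4 + 4 by ring, show 2 * (m + 2) = 2 * m + 4 by ring]
    omega
end

section
/- Let k ≥ 2 and let z be an integer with 2 ≤ z ≤ F_{2k}. Let l ≥ 2 be such that F_{2l−1} < z ≤ F_{2l}. Then s_F(F_{2k} − z) = (k − l) + s_F(F_{2l} − z), and consequently s_F(F_{2k} − z) ≥ k − (log z)/(2 log φ) − δ'/2, where δ' = (log √5)/(log φ) + 3/2. -/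
theorem greatestFib_fib_add {n m : ℕ} (hm : m < Nat.fib n) :
    Nat.greatestFib (Nat.fib (n + 1) + m) = n + 1 := by
  refine le_antisymm ?_ (Nat.le_greatestFib.2 (Nat.le_add_right _ _))
  rw [← Nat.lt_succ_iff, Nat.greatestFib_lt, Nat.succ_eq_add_one, Nat.fib_add_two (n := n)]
  omega

theorem sF_fib_add_s7 {n m : ℕ} (hm : m < Nat.fib n) :
    sF (Nat.fib (n + 1) + m) = 1 + sF m := by
  have hpos : 0 < Nat.fib (n + 1) := Nat.fib_pos.2 n.succ_pos
  rw [sF, Nat.zeckendorf_of_pos (by omega), greatestFib_fib_add hm, Nat.add_sub_cancel_left,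
    List.length_cons, sF, Nat.add_comm]

theorem sF_fib_two_mul_sub {l z : ℕ} (hz : 0 < z) (hl : z ≤ Nat.fib (2 * l)) (d : ℕ) :
    sF (Nat.fib (2 * (l + d)) - z) = d + sF (Nat.fib (2 * l) - z) := by
  induction d with
  | zero => simp
  | succ d ih =>
    have hle : z ≤ Nat.fib (2 * (l + d)) := hl.trans (Nat.fib_mono (by omega))
    have hsplit : Nat.fib (2 * (l + (d + 1))) - z =
        Nat.fib (2 * (l + d) + 1) + (Nat.fib (2 * (l + d)) - z) := by
      rw [show 2 * (l + (d + 1)) = 2 * (l + d) + 2 by ring, Nat.fib_add_two]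
      omega
    rw [hsplit, sF_fib_add_s7 (by omega), ih]
    omega

theorem goldenRatio_pow_le_sqrt_five_mul_fib {n : ℕ} (hn : Odd n) :
    Real.goldenRatio ^ n ≤ √5 * (Nat.fib n : ℝ) := by
  have h5 : (√5 : ℝ) ≠ 0 := by positivity
  rw [Real.coe_fib_eq, mul_div_cancel₀ _ h5]
  linarith [hn.pow_neg Real.goldenConj_neg]

theorem stmt_7 (k : ℕ) (hk : 2 ≤ k) (z : ℕ) (hz : 2 ≤ z) (hz' : z ≤ Nat.fib (2 * k))
    (l : ℕ) (hl2 : 2 ≤ l) (hl : Nat.fib (2 * l - 1) < z) (hl' : z ≤ Nat.fib (2 * l)) :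
    sF (Nat.fib (2 * k) - z) = (k - l) + sF (Nat.fib (2 * l) - z) ∧
      (sF (Nat.fib (2 * k) - z) : ℝ) ≥
        k - Real.log z / (2 * Real.log ((1 + Real.sqrt 5) / 2)) -
          (Real.log (Real.sqrt 5) / Real.log ((1 + Real.sqrt 5) / 2) + 3 / 2) / 2 := by
  have hlk : l ≤ k := by
    by_contra! h
    have := Nat.fib_mono (show 2 * k ≤ 2 * l - 1 by omega)
    omega
  have hsum : sF (Nat.fib (2 * k) - z) = (k - l) + sF (Nat.fib (2 * l) - z) := by
    have := sF_fib_two_mul_sub (by omega) hl' (k - l)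
    rwa [Nat.add_sub_cancel' hlk] at this
  refine ⟨hsum, ?_⟩
  change (_ : ℝ) ≥ k - Real.log z / (2 * Real.log Real.goldenRatio) -
    (Real.log √5 / Real.log Real.goldenRatio + 3 / 2) / 2
  have hlog : 0 < Real.log Real.goldenRatio := Real.log_pos Real.one_lt_goldenRatio
  have hz0 : (0 : ℝ) < z := by exact_mod_cast (by omega : 0 < z)
  have hpow : Real.goldenRatio ^ (2 * l - 1) ≤ √5 * z :=
    (goldenRatio_pow_le_sqrt_five_mul_fib ⟨l - 1, by omega⟩).trans (by gcongr)
  have hlogs := Real.log_le_log (pow_pos Real.goldenRatio_pos _) hpow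
  rw [Real.log_pow, Real.log_mul (by positivity) hz0.ne', Nat.cast_sub (by omega)] at hlogs
  push_cast at hlogs
  have hdiv := (le_div_iff₀ hlog).2 hlogs
  have hs : (0 : ℝ) ≤ sF (Nat.fib (2 * l) - z) := Nat.cast_nonneg _
  rw [hsum, Nat.cast_add, Nat.cast_sub hlk, mul_comm 2 (Real.log _), ← div_div]
  rw [add_div] at hdiv
  linarith
end

section
/- For every integer m ≥ 1 there exists k₀ = k₀(m) such that for all k ≥ k₀, s_F(m·L_k) < (log m)/(log φ) + 3. -/
open Real goldenRatio

theorem lucas_eq_goldenRatio_pow_add (k : ℕ) : (lucas k : ℝ) = φ ^ k + ψ ^ k := by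
  induction k using Nat.twoStepInduction with
  | zero => norm_num [lucas]
  | one => simp [lucas, goldenRatio_add_goldenConj]
  | more k ih₁ ih₂ =>
    have hrec : lucas (k + 2) = lucas (k + 1) + lucas k := by
      cases k with
      | zero => simp [lucas, Nat.fib_add_two]
      | succ k => simp only [lucas, Nat.fib_add_two]; ring
    rw [hrec, Nat.cast_add, ih₁, ih₂]
    linear_combination (-φ ^ k) * goldenRatio_sq - ψ ^ k * goldenConj_sq

theorem goldenRatio_pow_le_sum {b : ℕ} {l : List ℕ}
    (h : (b :: l).IsChain (fun x y ↦ x + 2 ≤ y)) :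
    φ ^ (b + 2 * l.length) ≤ ((b :: l).map (φ ^ ·)).sum := by
  induction l generalizing b with
  | nil => simp
  | cons c l ih =>
    rw [List.isChain_cons_cons] at h
    have hpow : φ ^ (b + 2 * (c :: l).length) ≤ φ ^ (c + 2 * l.length) :=
      pow_le_pow_right₀ one_lt_goldenRatio.le (by simp only [List.length_cons]; omega)
    have hb : 0 < φ ^ b := pow_pos goldenRatio_pos b
    rw [List.map_cons, List.sum_cons]
    linarith [ih h.2]

/-- If `u = φ⁻¹`, a sum of powers of `ψ = -u` with gaps at least two has the sign of its leading
term, and size between `u ^ (b + 1)` and `u ^ (b - 1)`. It is at least the leading term when the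
first gap is exactly two. -/
theorem alternating_sum_bounds {u : ℝ} (hu : 0 < u) (hsq : u ^ 2 = 1 - u) {b : ℕ} {l : List ℕ}
    (h : (b :: l).IsChain (fun x y ↦ x + 2 ≤ y)) :
    u ^ (b + 1) ≤ (-1) ^ b * ((b :: l).map ((-u) ^ ·)).sum ∧
      u * ((-1) ^ b * ((b :: l).map ((-u) ^ ·)).sum) ≤ u ^ b ∧
      ((b + 2) ∈ l.head? ∨ l = [] → u ^ b ≤ (-1) ^ b * ((b :: l).map ((-u) ^ ·)).sum) := by
  have hu1 : u ≤ 1 := by nlinarith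
  have hlead (n : ℕ) : (-1 : ℝ) ^ n * (-u) ^ n = u ^ n := by rw [← mul_pow]; simp
  have hb : 0 < u ^ b := pow_pos hu b
  induction l generalizing b with
  | nil =>
    simp only [List.map_cons, List.map_nil, List.sum_cons, List.sum_nil, add_zero, hlead]
    refine ⟨by rw [pow_succ]; nlinarith, by nlinarith, fun _ ↦ le_rfl⟩
  | cons c l ih =>
    rw [List.isChain_cons_cons] at h
    obtain ⟨hlow, hupp, -⟩ := ih h.2 (pow_pos hu c)
    rw [List.map_cons, List.sum_cons, mul_add, hlead]
    generalize ((c :: l).map ((-u) ^ ·)).sum = S at *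
    obtain ⟨d, rfl⟩ := Nat.exists_eq_add_of_le h.1
    have hT : 0 < (-1) ^ (b + 2 + d) * S := (pow_pos hu _).trans_le hlow
    rcases d with _ | d
    · have hsign : (-1 : ℝ) ^ (b + 2 + 0) * S = (-1) ^ b * S := by ring
      rw [hsign] at hupp hT
      have hu2 : u ^ (b + 2 + 0) = u ^ b * (1 - u) := by rw [← hsq]; ring
      rw [hu2] at hupp
      refine ⟨by rw [pow_succ]; nlinarith, by nlinarith, fun _ ↦ by linarith⟩
    · have hupp' : (-1) ^ (b + 2 + (d + 1)) * S ≤ u ^ (b + 2) := by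
        have hle : u ^ (b + 2 + (d + 1)) ≤ u * u ^ (b + 2) := by
          rw [← pow_succ']
          exact pow_le_pow_of_le_one hu.le hu1 (by omega)
        exact le_of_mul_le_mul_left (hupp.trans hle) hu
      have habs : |(-1) ^ b * S| ≤ u ^ (b + 2) := by
        have : |(-1) ^ b * S| = |(-1) ^ (b + 2 + (d + 1)) * S| := by simp [abs_mul]
        rw [this, abs_of_pos hT]
        exact hupp'
      have hu2 : u ^ (b + 2) = u ^ b * (1 - u) := by rw [← hsq]; ring
      rw [hu2, abs_le] at habs
      refine ⟨by rw [pow_succ]; linarith, ?_, fun hc ↦ ?_⟩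
      · have : u * (u ^ b + (-1) ^ b * S) ≤ u * (u ^ b + u ^ b * (1 - u)) := by
          exact mul_le_mul_of_nonneg_left (by linarith [habs.2]) hu.le
        have h3 : u * (1 + (1 - u)) ≤ 1 := by nlinarith [sq_nonneg (1 - u)]
        nlinarith
      · simp at hc

theorem inv_goldenRatio_sq : φ⁻¹ ^ 2 = 1 - φ⁻¹ := by
  rw [inv_goldenRatio]
  linear_combination goldenConj_sq

theorem goldenRatio_pow_le_sum_mul_abs_sum {b : ℕ} {l : List ℕ}
    (h : (b :: l).IsChain (fun x y ↦ x + 2 ≤ y)) :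
    φ ^ (2 * l.length) ≤ ((b :: l).map (φ ^ ·)).sum * |((b :: l).map (ψ ^ ·)).sum| := by
  have hφ := goldenRatio_pos
  obtain ⟨hlow, -, hlow'⟩ := alternating_sum_bounds (inv_pos.2 hφ) inv_goldenRatio_sq h
  have habs : (-1) ^ b * ((b :: l).map ((-φ⁻¹) ^ ·)).sum ≤ |((b :: l).map (ψ ^ ·)).sum| := by
    rw [inv_goldenRatio, neg_neg]
    refine (le_abs_self _).trans_eq ?_
    simp [abs_mul]
  have key {e f : ℕ} (hP : φ ^ (f + e) ≤ ((b :: l).map (φ ^ ·)).sum)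
      (hQ : φ⁻¹ ^ f ≤ |((b :: l).map (ψ ^ ·)).sum|) :
      φ ^ e ≤ ((b :: l).map (φ ^ ·)).sum * |((b :: l).map (ψ ^ ·)).sum| := by
    calc φ ^ e = φ ^ (f + e) * φ⁻¹ ^ f := by
          rw [pow_add, inv_pow]; field_simp
      _ ≤ _ := by
          gcongr
          exact (pow_pos hφ _).le.trans hP
  by_cases hc : (b + 2) ∈ l.head? ∨ l = []
  · exact key (goldenRatio_pow_le_sum h) ((hlow' hc).trans habs)
  · refine key ?_ (hlow.trans habs)
    cases l with
    | nil => simp at hc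
    | cons c l =>
      rw [List.isChain_cons_cons] at h
      simp only [List.head?_cons, Option.mem_def, Option.some.injEq, reduceCtorEq, or_false] at hc
      have hpow : φ ^ (b + 1 + 2 * (c :: l).length) ≤ φ ^ (c + 2 * l.length) :=
        pow_le_pow_right₀ one_lt_goldenRatio.le (by simp only [List.length_cons]; omega)
      have hb : 0 < φ ^ b := pow_pos hφ b
      rw [List.map_cons, List.sum_cons]
      linarith [goldenRatio_pow_le_sum h.2]

theorem abs_goldenConj : |ψ| = φ⁻¹ := by
  rw [inv_goldenRatio, abs_of_neg goldenConj_neg]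

theorem abs_sum_goldenConj_pow_le {b : ℕ} {l : List ℕ} (hb : 2 ≤ b)
    (h : (b :: l).IsChain (fun x y ↦ x + 2 ≤ y)) :
    |((b :: l).map (ψ ^ ·)).sum| ≤ φ⁻¹ := by
  have hu : 0 < φ⁻¹ := inv_pos.2 goldenRatio_pos
  obtain ⟨hlow, hupp, -⟩ := alternating_sum_bounds hu inv_goldenRatio_sq h
  have habs : |((b :: l).map (ψ ^ ·)).sum| = (-1) ^ b * ((b :: l).map ((-φ⁻¹) ^ ·)).sum := by
    rw [← abs_of_pos ((pow_pos hu _).trans_le hlow), inv_goldenRatio, neg_neg]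
    simp [abs_mul]
  rw [habs]
  refine le_of_mul_le_mul_left (hupp.trans ?_) hu
  rw [← pow_two]
  exact pow_le_pow_of_le_one hu.le (inv_le_one_of_one_le₀ one_lt_goldenRatio.le) hb

theorem sum_fib_succ_sub (l : List ℕ) :
    (((l.map (fun c ↦ Nat.fib (c + 1))).sum : ℕ) : ℝ) - φ * ((l.map Nat.fib).sum : ℕ) =
      (l.map (ψ ^ ·)).sum := by
  induction l with
  | nil => simp
  | cons c l ih =>
    simp only [List.map_cons, List.sum_cons, Nat.cast_add]
    linear_combination ih + fib_succ_sub_goldenRatio_mul_fib c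

theorem sum_fib_succ_sub' (l : List ℕ) :
    (((l.map (fun c ↦ Nat.fib (c + 1))).sum : ℕ) : ℝ) - ψ * ((l.map Nat.fib).sum : ℕ) =
      (l.map (φ ^ ·)).sum := by
  induction l with
  | nil => simp
  | cons c l ih =>
    have hc := fib_succ_sub_goldenConj_mul_fib c
    simp only [List.map_cons, List.sum_cons, Nat.cast_add]
    linear_combination ih + hc

theorem goldenRatio_pow_length_le {m k : ℕ} (hk : m * √5 * φ⁻¹ ^ k < 1 - φ⁻¹) {b : ℕ}
    {l : List ℕ} (hb : 2 ≤ b) (h : (b :: l).IsChain (fun x y ↦ x + 2 ≤ y))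
    (hsum : ((b :: l).map Nat.fib).sum = m * lucas k) :
    φ ^ l.length ≤ m * √5 := by
  have hψ := sum_fib_succ_sub (b :: l)
  have hφ := sum_fib_succ_sub' (b :: l)
  have hbound := abs_sum_goldenConj_pow_le hb h
  have hmul := goldenRatio_pow_le_sum_mul_abs_sum h
  have hsub : φ - ψ = √5 := goldenRatio_sub_goldenConj
  have hL := lucas_eq_goldenRatio_pow_add
  rw [hsum] at hψ hφ
  generalize ((b :: l).map (fun c ↦ Nat.fib (c + 1))).sum = M at *
  have hconj : |(m : ℝ) * √5 * ψ ^ k| = m * √5 * φ⁻¹ ^ k := by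
    rw [abs_mul, abs_pow, abs_goldenConj, abs_of_nonneg (by positivity)]
  have hM : M = m * lucas (k + 1) := by
    have hdiff : (M : ℝ) - (m * lucas (k + 1) : ℕ) =
        ((b :: l).map (ψ ^ ·)).sum + m * √5 * ψ ^ k := by
      rw [← hψ, ← hsub]
      push_cast
      rw [hL, hL]
      ring
    have hlt : |(M : ℝ) - (m * lucas (k + 1) : ℕ)| < 1 := by
      rw [hdiff]
      refine (abs_add_le _ _).trans_lt ?_
      rw [hconj]
      linarith
    have hlt' : |(M : ℤ) - (m * lucas (k + 1) : ℕ)| < 1 := by exact_mod_cast hlt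
    have := Int.abs_lt_one_iff.1 hlt'
    omega
  have hψ' : ((b :: l).map (ψ ^ ·)).sum = -(m * √5 * ψ ^ k) := by
    rw [← hψ, hM, ← hsub]
    push_cast
    rw [hL, hL]
    ring
  have hφ' : ((b :: l).map (φ ^ ·)).sum = m * √5 * φ ^ k := by
    rw [← hφ, hM, ← hsub]
    push_cast
    rw [hL, hL]
    ring
  rw [hψ', hφ', abs_neg, hconj] at hmul
  have hone : φ ^ k * φ⁻¹ ^ k = 1 := by
    rw [← mul_pow, mul_inv_cancel₀ goldenRatio_ne_zero, one_pow]
  refine le_of_sq_le_sq ?_ (by positivity)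
  calc (φ ^ l.length) ^ 2 = φ ^ (2 * l.length) := by rw [← pow_mul, mul_comm]
    _ ≤ _ := hmul
    _ = (m * √5) ^ 2 := by linear_combination (m * √5) ^ 2 * hone

theorem stmt_10 (m : ℕ) (hm : 1 ≤ m) :
    ∃ k₀ : ℕ, ∀ k : ℕ, k₀ ≤ k →
      (sF (m * lucas k) : ℝ) < Real.log m / Real.log ((1 + Real.sqrt 5) / 2) + 3 := by
  have hu : 0 < φ⁻¹ := inv_pos.2 goldenRatio_pos
  have hu1 : φ⁻¹ < 1 := inv_lt_one_of_one_lt₀ one_lt_goldenRatio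
  have hlim : Filter.Tendsto (fun k : ℕ ↦ m * √5 * φ⁻¹ ^ k) Filter.atTop (nhds 0) := by
    simpa using (tendsto_pow_atTop_nhds_zero_of_lt_one hu.le hu1).const_mul (m * √5)
  obtain ⟨k₀, hk₀⟩ := Filter.eventually_atTop.1
    (hlim.eventually_lt_const (show 0 < 1 - φ⁻¹ by linarith))
  refine ⟨k₀, fun k hk ↦ ?_⟩
  change _ < Real.log m / Real.log φ + 3
  have hlog : 0 < Real.log φ := Real.log_pos one_lt_goldenRatio
  have hm' : (1 : ℝ) ≤ m := by exact_mod_cast hm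
  have hchain : (0 :: (Nat.zeckendorf (m * lucas k)).reverse).IsChain (fun x y ↦ x + 2 ≤ y) := by
    have := Nat.isZeckendorfRep_zeckendorf (m * lucas k)
    rw [List.IsZeckendorfRep, ← List.isChain_reverse] at this
    simpa using this
  have hsum : ((Nat.zeckendorf (m * lucas k)).reverse.map Nat.fib).sum = m * lucas k := by
    rw [List.map_reverse, List.sum_reverse, Nat.sum_zeckendorf_fib]
  rw [sF, ← List.length_reverse]
  generalize (Nat.zeckendorf (m * lucas k)).reverse = r at *
  cases r with
  | nil =>
    have : 0 ≤ Real.log m / Real.log φ := div_nonneg (Real.log_nonneg hm') hlog.le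
    simp only [List.length_nil, Nat.cast_zero]
    linarith
  | cons b l =>
    rw [List.isChain_cons_cons] at hchain
    have hle := goldenRatio_pow_length_le (hk₀ k hk) (by omega) hchain.2 hsum
    have hsqrt : √5 < φ ^ 2 := by
      rw [goldenRatio_sq, goldenRatio]
      have : √5 < 3 := by rw [Real.sqrt_lt' (by norm_num)]; norm_num
      linarith
    have hlt : φ ^ l.length < m * φ ^ 2 := hle.trans_lt (by gcongr)
    have hloglt := Real.log_lt_log (pow_pos goldenRatio_pos _) hlt
    rw [Real.log_mul (by positivity) (by positivity), Real.log_pow, Real.log_pow] at hloglt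
    have hdiv : (l.length : ℝ) - 2 < Real.log m / Real.log φ := by
      rw [lt_div_iff₀ hlog]
      push_cast at hloglt
      linarith
    rw [List.length_cons]
    push_cast
    linarith
end

section
/- For every integer k ≥ 1, the integer n_k = L_{8k} + L_{6k} + L_{4k} + L_{2k} − 1 satisfies the identity n_k² = L_{16k} + 2L_{14k} + 3L_{12k} + 4L_{10k} + L_{8k} + 2L_{6k} + 3L_{4k} + 4L_{2k} + 9. -/
open Real in
/-- Binet's formula for the Lucas numbers. -/
theorem coe_lucas_eq (n : ℕ) : (lucas n : ℝ) = goldenRatio ^ n + goldenConj ^ n := by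
  induction n using Nat.twoStepInduction with
  | zero => norm_num [lucas]
  | one => simp [lucas, goldenRatio_add_goldenConj]
  | more n ih₀ ih₁ =>
    have hrec : lucas (n + 2) = lucas n + lucas (n + 1) := by
      cases n with
      | zero => rfl
      | succ m =>
        simp only [lucas, Nat.fib_add_two]
        ring
    rw [hrec, Nat.cast_add, ih₀, ih₁]
    linear_combination -goldenRatio ^ n * goldenRatio_sq - goldenConj ^ n * goldenConj_sq

theorem lucas_pos (n : ℕ) : 0 < lucas n := by
  cases n with
  | zero => decide
  | succ n => exact Nat.add_pos_right _ (Nat.fib_pos.2 (by omega))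

open Real in
theorem lucas_add_mul_lucas_of_even {n : ℕ} (hn : Even n) (d : ℕ) :
    lucas (n + d) * lucas n = lucas (2 * n + d) + lucas d := by
  have h : goldenRatio ^ n * goldenConj ^ n = 1 := by
    rw [← mul_pow, goldenRatio_mul_goldenConj, hn.neg_one_pow]
  have key : (lucas (n + d) : ℝ) * lucas n = lucas (2 * n + d) + lucas d := by
    simp only [coe_lucas_eq]
    linear_combination (goldenRatio ^ d + goldenConj ^ d) * h
  exact_mod_cast key

theorem stmt_16 (k : ℕ) (hk : 1 ≤ k) :
    (lucas (8 * k) + lucas (6 * k) + lucas (4 * k) + lucas (2 * k) - 1) ^ 2 =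
      lucas (16 * k) + 2 * lucas (14 * k) + 3 * lucas (12 * k) + 4 * lucas (10 * k) +
        lucas (8 * k) + 2 * lucas (6 * k) + 3 * lucas (4 * k) + 4 * lucas (2 * k) + 9 := by
  have hmul (a b : ℕ) : lucas (2 * (a + b) * k) * lucas (2 * a * k) =
      lucas (2 * (2 * a + b) * k) + lucas (2 * b * k) := by
    have h := lucas_add_mul_lucas_of_even (n := 2 * a * k) ⟨a * k, by ring⟩ (2 * b * k)
    convert h using 3 <;> ring
  have h40 := hmul 4 0
  have h30 := hmul 3 0
  have h20 := hmul 2 0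
  have h10 := hmul 1 0
  have h31 := hmul 3 1
  have h22 := hmul 2 2
  have h13 := hmul 1 3
  have h21 := hmul 2 1
  have h12 := hmul 1 2
  have h11 := hmul 1 1
  have h0 : lucas 0 = 2 := rfl
  norm_num [h0] at h40 h30 h20 h10 h31 h22 h13 h21 h12 h11
  have hpos := lucas_pos (2 * k)
  zify [show 1 ≤ lucas (8 * k) + lucas (6 * k) + lucas (4 * k) + lucas (2 * k) by omega] at *
  linear_combination h40 + h30 + h20 + h10 + 2 * (h31 + h22 + h13 + h21 + h12 + h11)
end
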